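/- Consider the Gaussian additive model with |S_N| = M_N. For every N and every λ ≥ 0, D(Q_{λ,N} ‖ Q_{0,N}) ≥ λ/2 − log M_N. -/

import Mathlib

open MeasureTheory ProbabilityTheory Filter Real
open scoped ENNReal NNReal

noncomputable section

/-- Vectors in `ℝ^N`. -/
abbrev V (N : ℕ) : Type := Fin N → ℝ

/-- Euclidean inner product on `ℝ^N`. -/
def inp {N : ℕ} (x y : V N) : ℝ := ∑ i, x i * y i

/-- `S` is a subset of the unit sphere of `ℝ^N`. -/
def onSphere {N : ℕ} (S : Finset (V N)) : Prop := ∀ x ∈ S, ∑ i, (x i) ^ 2 = 1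

/-- The standard Gaussian measure on `ℝ^N`. -/
def stdGaussian (N : ℕ) : Measure (V N) :=
  Measure.pi fun _ : Fin N => gaussianReal 0 1

/-- The uniform probability measure on a finite set of vectors. -/
def unifOn {N : ℕ} (S : Finset (V N)) : Measure (V N) :=
  (S.card : ℝ≥0∞)⁻¹ • ∑ x ∈ S, Measure.dirac x

/-- The joint law of `(X, Y)` where `X` is uniform on `S`, `Z` is an independent standard
Gaussian vector, and `Y = √λ • X + Z`. -/
def jointLaw (N : ℕ) (S : Finset (V N)) (lam : ℝ) : Measure (V N × V N) :=
  ((unifOn S).prod (stdGaussian N)).map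
    (fun q => (q.1, fun i => Real.sqrt lam * q.1 i + q.2 i))

/-- `Q N S lam` : the law of the observation `Y = √λ • X + Z`. -/
def Q (N : ℕ) (S : Finset (V N)) (lam : ℝ) : Measure (V N) :=
  (jointLaw N S lam).map Prod.snd

/-- Kullback–Leibler divergence `D(μ ‖ ν) = ∫ log (dμ/dν) dμ` (real-valued). -/
def klReal {α : Type*} [MeasurableSpace α] (μ ν : Measure α) : ℝ :=
  ∫ x, Real.log (μ.rnDeriv ν x).toReal ∂μ

/-- The σ-algebra generated by the observation `Y` (the second coordinate). -/
def sigmaY (N : ℕ) : MeasurableSpace (V N × V N) :=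
  MeasurableSpace.comap Prod.snd inferInstance

/-- The minimum mean squared error `E‖X - E[X | Y]‖²` at SNR `lam`. -/
def mmse (N : ℕ) (S : Finset (V N)) (lam : ℝ) : ℝ :=
  ∑ i : Fin N,
    ∫ ω, (ω.1 i - ((jointLaw N S lam)[fun ω' => ω'.1 i | sigmaY N]) ω) ^ 2
      ∂(jointLaw N S lam)

/-- The all-or-nothing phenomenon with critical SNR sequence `lam`. -/
def allOrNothing (S : ∀ N : ℕ, Finset (V N)) (lam : ℕ → ℝ) : Prop :=
  (∀ β : ℝ, 0 ≤ β → β < 1 →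
    Tendsto (fun N => mmse N (S N) (β * lam N)) atTop (nhds 1)) ∧
  (∀ β : ℝ, 1 < β →
    Tendsto (fun N => mmse N (S N) (β * lam N)) atTop (nhds 0))

/-- `limsup_N (1 / log M_N) · log P_N^{⊗2}[⟨X, X'⟩ ≥ t] ≤ c`, where `X, X'` are i.i.d.
draws from the uniform distribution on `S N`: for every `ε > 0`, eventually the probability
that the overlap is at least `t` is at most `M_N ^ (c + ε)`. -/
def overlapRateLe (S : ∀ N : ℕ, Finset (V N)) (t c : ℝ) : Prop :=
  ∀ ε : ℝ, 0 < ε → ∀ᶠ N in atTop,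
    ((unifOn (S N)).prod (unifOn (S N))) {q | t ≤ inp q.1 q.2}
      ≤ ((S N).card : ℝ≥0∞) ^ (c + ε)

/-- The spread assumption: `lim_{t→1⁻} limsup_N (1/log M_N) log P_N^{⊗2}[⟨X,X'⟩ ≥ t] ≤ -1`. -/
def spread (S : ∀ N : ℕ, Finset (V N)) : Prop :=
  ∀ ε : ℝ, 0 < ε → ∃ t₀ : ℝ, t₀ < 1 ∧ ∀ t : ℝ, t₀ < t → t < 1 →
    overlapRateLe S t (-1 + ε)

lemma my_pi_withDensity {N : ℕ} (μ : Fin N → Measure ℝ) [∀ i, IsProbabilityMeasure (μ i)]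
    (f : Fin N → ℝ → ℝ≥0∞) (hf : ∀ i, Measurable (f i))
    [∀ i, SigmaFinite ((μ i).withDensity (f i))] :
    Measure.pi (fun i => (μ i).withDensity (f i))
      = (Measure.pi μ).withDensity (fun x => ∏ i, f i (x i)) := by
  refine Measure.pi_eq fun s hs => ?_
  rw [withDensity_apply _ (.univ_pi hs), ← lintegral_indicator (.univ_pi hs)]
  have h1 : ∀ x : Fin N → ℝ, (Set.univ.pi s).indicator (fun x => ∏ i, f i (x i)) x
      = ∏ i, ((s i).indicator (f i)) (x i) := by
    intro x
    by_cases hx : x ∈ Set.univ.pi s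
    · rw [Set.indicator_of_mem hx]
      exact Finset.prod_congr rfl fun i _ => (Set.indicator_of_mem (hx i trivial) _).symm
    · rw [Set.indicator_of_notMem hx]
      simp only [Set.mem_pi, not_forall] at hx
      obtain ⟨i, _, hi⟩ := hx
      exact (Finset.prod_eq_zero (Finset.mem_univ i) (Set.indicator_of_notMem hi _)).symm
  simp_rw [h1]
  have hm : ∀ i, Measurable ((s i).indicator (f i)) := fun i => (hf i).indicator (hs i)
  have hind : iIndepFun (fun i (x : Fin N → ℝ) => (s i).indicator (f i) (x i)) (Measure.pi μ) :=
    iIndepFun_pi (fun i => (hm i).aemeasurable)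
  have := lintegral_prod_eq_prod_lintegral_of_indepFun Finset.univ _ hind
    (fun i => (hm i).comp (measurable_pi_apply i))
  rw [this]
  refine Finset.prod_congr rfl fun i _ => ?_
  rw [withDensity_apply _ (hs i), ← lintegral_indicator (hs i)]
  have := (measurePreserving_eval μ i).lintegral_comp (hm i)
  exact this

lemma shift_one (a : ℝ) : (gaussianReal 0 1).map (fun z => a + z)
    = (gaussianReal 0 1).withDensity (fun y => ENNReal.ofReal (Real.exp (a * y - a ^ 2 / 2))) := by
  rw [gaussianReal_map_const_add, gaussianReal_of_var_ne_zero _ one_ne_zero,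
    gaussianReal_of_var_ne_zero _ one_ne_zero, ← withDensity_mul _ (by fun_prop) (by fun_prop)]
  congr 1
  ext y
  simp only [Pi.mul_apply, gaussianPDF, gaussianPDFReal]
  rw [← ENNReal.ofReal_mul (by positivity), mul_assoc _ (Real.exp _) (Real.exp _), ← Real.exp_add]
  congr 3
  simp only [NNReal.coe_one]
  ring

lemma shift_pi {N : ℕ} (v : V N) : (_root_.stdGaussian N).map (fun z i => v i + z i)
    = (_root_.stdGaussian N).withDensity
        (fun y => ENNReal.ofReal (Real.exp (inp v y - (∑ i, v i ^ 2) / 2))) := by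
  have h0 : ∀ i : Fin N, IsProbabilityMeasure ((gaussianReal 0 1).map (fun z => v i + z)) :=
    fun i => Measure.isProbabilityMeasure_map (by fun_prop)
  unfold _root_.stdGaussian
  rw [Measure.pi_map_pi (f := fun i z => v i + z) (fun i => by fun_prop)]
  simp_rw [shift_one]
  simp_rw [shift_one] at h0
  rw [my_pi_withDensity _ _ (fun i => by fun_prop)]
  congr 1
  ext y
  rw [← ENNReal.ofReal_prod_of_nonneg (fun i _ => by positivity), ← Real.exp_sum]
  simp [inp, Finset.sum_sub_distrib, Finset.sum_div]

instance {N : ℕ} : IsProbabilityMeasure (_root_.stdGaussian N) := by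
  unfold _root_.stdGaussian; infer_instance

lemma unif_prob {N : ℕ} {S : Finset (V N)} (hne : S.Nonempty) :
    IsProbabilityMeasure (unifOn S) := by
  constructor
  simp [unifOn]
  exact ENNReal.inv_mul_cancel (by simpa using hne.ne_empty) (by simp)

lemma Q_eq (N : ℕ) (S : Finset (V N)) (lam : ℝ) : Q N S lam =
    (S.card : ℝ≥0∞)⁻¹ • ∑ x ∈ S, (_root_.stdGaussian N).map (fun z i => √lam * x i + z i) := by
  have hm : Measurable (fun q : V N × V N => fun i => √lam * q.1 i + q.2 i) := by fun_prop
  unfold Q jointLaw unifOn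
  rw [Measure.map_map measurable_snd (by fun_prop)]
  change Measure.map (fun q : V N × V N => fun i => √lam * q.1 i + q.2 i) _ = _
  rw [Measure.prod_smul_left, Measure.map_smul]
  congr 1
  ext s hs
  rw [Measure.map_apply hm hs, Measure.prod_apply (hm hs), lintegral_finsetSum_measure,
    Measure.finsetSum_apply]
  refine Finset.sum_congr rfl fun x _ => ?_
  rw [lintegral_dirac' _ (measurable_measure_prodMk_left (hm hs)),
    Measure.map_apply (by fun_prop) hs]
  rfl

lemma Q_zero (N : ℕ) (S : Finset (V N)) (hne : S.Nonempty) : Q N S 0 = _root_.stdGaussian N := by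
  rw [Q_eq]
  simp only [Real.sqrt_zero, zero_mul, zero_add]
  simp only [Measure.map_id', Finset.sum_const]
  rw [← Nat.cast_smul_eq_nsmul ℝ≥0∞, smul_smul, ENNReal.inv_mul_cancel (by simpa using hne.ne_empty) (by simp), one_smul]

/-- likelihood ratio -/
def LR {N : ℕ} (S : Finset (V N)) (lam : ℝ) (y : V N) : ℝ :=
  (S.card : ℝ)⁻¹ * ∑ x ∈ S, Real.exp (√lam * inp x y - lam / 2)

lemma Q_density (N : ℕ) (S : Finset (V N)) (hne : S.Nonempty) (hsphere : onSphere S)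
    (lam : ℝ) (hlam : 0 ≤ lam) :
    Q N S lam = (_root_.stdGaussian N).withDensity (fun y => ENNReal.ofReal (LR S lam y)) := by
  have hc : (0 : ℝ) < S.card := by exact_mod_cast hne.card_pos
  have hmi : ∀ x : V N, Measurable (fun y => inp x y) := fun x => by unfold inp; fun_prop
  rw [Q_eq]
  ext s hs
  rw [withDensity_apply _ hs, Measure.smul_apply, Measure.finsetSum_apply]
  have : ∀ x ∈ S, (_root_.stdGaussian N).map (fun z i => √lam * x i + z i) s
      = ∫⁻ y in s, ENNReal.ofReal (Real.exp (√lam * inp x y - lam / 2)) ∂(_root_.stdGaussian N) := by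
    intro x hx
    rw [shift_pi (fun i => √lam * x i), withDensity_apply _ hs]
    have h2 : ∑ i, (√lam * x i) ^ 2 = lam := by
      simp_rw [mul_pow, Real.sq_sqrt hlam]
      rw [← Finset.mul_sum, hsphere x hx, mul_one]
    rw [h2]
    congr 1
    ext y
    simp [inp, Finset.mul_sum, mul_assoc]
  rw [Finset.sum_congr rfl this, ← lintegral_finsetSum _ (fun x _ => by have := hmi x; fun_prop),
    smul_eq_mul, ← lintegral_const_mul _ (Finset.measurable_fun_sum _ (fun x _ => by have := hmi x; fun_prop))]
  congr 1
  ext y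
  rw [LR, ENNReal.ofReal_mul (by positivity), ENNReal.ofReal_inv_of_pos hc,
    ENNReal.ofReal_natCast, ENNReal.ofReal_sum_of_nonneg (fun i _ => by positivity)]

lemma gauss_int {N : ℕ} (x : V N) : Integrable (fun z => inp x z) (_root_.stdGaussian N) ∧
    ∫ z, inp x z ∂(_root_.stdGaussian N) = 0 := by
  unfold inp _root_.stdGaussian
  have h1 : ∀ i : Fin N, Integrable (fun z : V N => z i)
      (Measure.pi fun _ : Fin N => gaussianReal 0 1) := fun i =>
    integrable_comp_eval (μ := fun _ : Fin N => gaussianReal 0 1) (i := i) (f := fun x : ℝ => x)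
      ((memLp_id_gaussianReal 1).integrable le_rfl)
  refine ⟨integrable_finsetSum _ fun i _ => (h1 i).const_mul _, ?_⟩
  rw [integral_finsetSum _ fun i _ => (h1 i).const_mul _]
  refine Finset.sum_eq_zero fun i _ => ?_
  rw [integral_const_mul,
    integral_comp_eval (μ := fun _ : Fin N => gaussianReal 0 1) (i := i) (f := fun x : ℝ => x)
      (by fun_prop)]
  simp

lemma LR_lower {N : ℕ} (S : Finset (V N)) (lam : ℝ) (x : V N) (hx : x ∈ S) (y : V N) :
    √lam * inp x y - lam / 2 - Real.log S.card ≤ Real.log (LR S lam y) := by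
  have hc : (0 : ℝ) < S.card := by exact_mod_cast Finset.card_pos.mpr ⟨x, hx⟩
  have h1 := Finset.single_le_sum (f := fun x => Real.exp (√lam * inp x y - lam / 2))
    (fun i _ => (Real.exp_pos _).le) hx
  have h2 : 0 < ∑ x ∈ S, Real.exp (√lam * inp x y - lam / 2) :=
    lt_of_lt_of_le (Real.exp_pos _) h1
  rw [LR, Real.log_mul (by positivity) h2.ne', Real.log_inv]
  have h3 := Real.log_le_log (Real.exp_pos _) h1
  rw [Real.log_exp] at h3
  linarith

lemma LR_upper {N : ℕ} (S : Finset (V N)) (hne : S.Nonempty) (lam : ℝ) (hlam : 0 ≤ lam) (y : V N) :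
    Real.log (LR S lam y) ≤ ∑ x ∈ S, √lam * |inp x y| := by
  have hc : (0 : ℝ) < S.card := by exact_mod_cast hne.card_pos
  have h2 : 0 < ∑ x ∈ S, Real.exp (√lam * inp x y - lam / 2) :=
    Finset.sum_pos (fun _ _ => Real.exp_pos _) hne
  have h0 : 0 < LR S lam y := by unfold LR; positivity
  rw [Real.log_le_iff_le_exp h0, LR, inv_mul_le_iff₀ hc, ← nsmul_eq_mul]
  refine Finset.sum_le_card_nsmul _ _ _ fun x hx => Real.exp_le_exp.mpr ?_
  have h1 := Finset.single_le_sum (f := fun x => √lam * |inp x y|)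
    (fun i _ => by positivity) hx
  have h3 := mul_le_mul_of_nonneg_left (le_abs_self (inp x y)) (Real.sqrt_nonneg lam)
  linarith

/-- Lemma 3 of the paper. For every `N` and `λ ≥ 0`,
`D(Q_{λ,N} ‖ Q_{0,N}) ≥ λ/2 - log M_N`. -/
theorem statement13 (N : ℕ) (S : Finset (V N)) (hne : S.Nonempty) (hsphere : onSphere S)
    (lam : ℝ) (hlam : 0 ≤ lam) :
    lam / 2 - Real.log S.card ≤ klReal (Q N S lam) (Q N S 0) := by
  have hc : (0 : ℝ) < S.card := by exact_mod_cast hne.card_pos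
  have hmi : ∀ x : V N, Measurable (fun y => inp x y) := fun x => by unfold inp; fun_prop
  have hLm : Measurable (LR S lam) := by
    unfold LR
    exact (Finset.measurable_fun_sum _ (fun x _ => by have := hmi x; fun_prop)).const_mul _
  have hL0 : ∀ y, 0 ≤ LR S lam y := fun y => by unfold LR; positivity
  have hac : Q N S lam ≪ _root_.stdGaussian N := by
    rw [Q_density N S hne hsphere lam hlam]; exact withDensity_absolutelyContinuous _ _
  have hrn : (Q N S lam).rnDeriv (_root_.stdGaussian N)
      =ᵐ[_root_.stdGaussian N] fun y => ENNReal.ofReal (LR S lam y) := by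
    rw [Q_density N S hne hsphere lam hlam]
    exact Measure.rnDeriv_withDensity _ (by fun_prop)
  have hkl : klReal (Q N S lam) (Q N S 0) = ∫ y, Real.log (LR S lam y) ∂(Q N S lam) := by
    rw [Q_zero N S hne, klReal]
    refine integral_congr_ae ?_
    filter_upwards [hac.ae_le hrn] with y hy
    rw [hy, ENNReal.toReal_ofReal (hL0 y)]
  -- inner product shift
  have hin : ∀ x x' z : V N, inp x' (fun i => √lam * x i + z i) = √lam * inp x' x + inp x' z := by
    intro x x' z
    simp only [inp, Finset.mul_sum, ← Finset.sum_add_distrib]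
    exact Finset.sum_congr rfl fun i _ => by ring
  have hshm : ∀ x : V N, Measurable (fun (z : V N) (i : Fin N) => √lam * x i + z i) :=
    fun x => by fun_prop
  have hlow_int : ∀ x x' : V N, Integrable
      (fun z : V N => inp x' (fun i => √lam * x i + z i)) (_root_.stdGaussian N) := by
    intro x x'
    simp_rw [hin]
    exact (integrable_const _).add (gauss_int x').1
  have hlogm : Measurable (fun y => Real.log (LR S lam y)) := Real.measurable_log.comp hLm
  have hint : ∀ x ∈ S, Integrable (fun z : V N => Real.log (LR S lam (fun i => √lam * x i + z i)))
      (_root_.stdGaussian N) := by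
    intro x hx
    refine integrable_of_le_of_le (hlogm.comp (hshm x)).aestronglyMeasurable
      (ae_of_all _ fun z => LR_lower S lam x hx _) (ae_of_all _ fun z => LR_upper S hne lam hlam _)
      ((((hlow_int x x).const_mul _).sub (integrable_const _)).sub (integrable_const _))
      (integrable_finsetSum _ fun x' _ => (hlow_int x x').abs.const_mul _)
  have hint' : ∀ x ∈ S, Integrable (fun y : V N => Real.log (LR S lam y))
      ((_root_.stdGaussian N).map (fun z i => √lam * x i + z i)) := fun x hx =>
    (integrable_map_measure hlogm.aestronglyMeasurable (hshm x).aemeasurable).mpr (hint x hx)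
  have hval : ∀ x ∈ S, lam / 2 - Real.log S.card ≤
      ∫ y, Real.log (LR S lam y) ∂((_root_.stdGaussian N).map (fun z i => √lam * x i + z i)) := by
    intro x hx
    rw [integral_map (hshm x).aemeasurable hlogm.aestronglyMeasurable]
    have hxx : inp x x = 1 := by
      rw [← hsphere x hx]; exact Finset.sum_congr rfl fun i _ => (sq (x i)).symm
    have h1 : ∀ z : V N, lam / 2 - Real.log S.card + √lam * inp x z
        ≤ Real.log (LR S lam (fun i => √lam * x i + z i)) := by
      intro z
      have := LR_lower S lam x hx (fun i => √lam * x i + z i)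
      rw [hin, hxx] at this
      have hs := Real.mul_self_sqrt hlam
      nlinarith
    have h2 := integral_mono ((integrable_const _).add ((gauss_int x).1.const_mul _)) (hint x hx) h1
    rw [integral_add' (integrable_const _) ((gauss_int x).1.const_mul _), integral_const_mul,
      (gauss_int x).2] at h2
    simpa using h2
  rw [hkl, Q_eq, integral_smul_measure, integral_finsetSum_measure hint']
  have h3 := Finset.card_nsmul_le_sum S _ _ hval
  rw [nsmul_eq_mul] at h3
  simp only [ENNReal.toReal_inv, ENNReal.toReal_natCast, smul_eq_mul]
  rwa [le_inv_mul_iff₀ hc]
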